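/- Let r ≥ 2 and t ≥ 1 be integers and set m = r·t + 1. Then the additive submonoid H of ℕ generated by the consecutive integers m − t, m − t + 1, …, m satisfies: the cardinality of ℕ \ H equals (m−1)(r−1)/2. -/

import Mathlib

/-- The submonoid of `ℕ` generated by an interval `[a, b]` is the union of the intervals
`[k * a, k * b]`. -/
theorem mem_closure_interval_iff {a b : ℕ} (hab : a ≤ b) (x : ℕ) :
    x ∈ AddSubmonoid.closure {k : ℕ | a ≤ k ∧ k ≤ b} ↔ ∃ k, k * a ≤ x ∧ x ≤ k * b := by
  constructor
  · intro hx
    induction hx using AddSubmonoid.closure_induction with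
    | mem y hy => exact ⟨1, by simpa using hy⟩
    | zero => exact ⟨0, by simp⟩
    | add y z _ _ hy hz =>
      obtain ⟨i, hi, hi'⟩ := hy
      obtain ⟨j, hj, hj'⟩ := hz
      exact ⟨i + j, by rw [add_mul]; omega, by rw [add_mul]; omega⟩
  · rintro ⟨k, hk, hk'⟩
    induction k generalizing x with
    | zero =>
      obtain rfl : x = 0 := by omega
      exact zero_mem _
    | succ k ih =>
      rw [add_mul, one_mul] at hk hk'
      have hkab : k * a ≤ k * b := Nat.mul_le_mul_left k hab
      have hx : x = (x - max a (x - k * b)) + max a (x - k * b) := by omega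
      rw [hx]
      exact add_mem (ih _ (by omega) (by omega))
        (AddSubmonoid.subset_closure ⟨by omega, by omega⟩)

/-- The gaps of the semigroup generated by `[s * t + 1, (s + 1) * t + 1]` form `s` intervals. -/
theorem notMem_closure_interval_iff (s t x : ℕ) :
    x ∉ AddSubmonoid.closure {k : ℕ | s * t + 1 ≤ k ∧ k ≤ (s + 1) * t + 1} ↔
      ∃ k < s, k * ((s + 1) * t + 1) < x ∧ x < (k + 1) * (s * t + 1) := by
  have hab : s * t + 1 ≤ (s + 1) * t + 1 := by gcongr; omega
  rw [mem_closure_interval_iff hab]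
  constructor
  · intro h
    push Not at h
    have hlow : x / ((s + 1) * t + 1) * ((s + 1) * t + 1) ≤ x := Nat.div_mul_le_self _ _
    have hup : x < (x / ((s + 1) * t + 1) + 1) * ((s + 1) * t + 1) :=
      (Nat.div_lt_iff_lt_mul (Nat.succ_pos _)).mp (Nat.lt_succ_self _)
    generalize x / ((s + 1) * t + 1) = k at hlow hup
    have h₁ := h k ((Nat.mul_le_mul_left k hab).trans hlow)
    have h₂ : x < (k + 1) * (s * t + 1) := by
      by_contra hc
      have := h (k + 1) (not_lt.mp hc)
      omega
    refine ⟨k, ?_, h₁, h₂⟩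
    by_contra hsk
    have := Nat.mul_le_mul_right t (not_lt.mp hsk)
    nlinarith
  · rintro ⟨k, -, hk, hk'⟩ ⟨j, hj, hj'⟩
    have h₁ : j < k + 1 := lt_of_mul_lt_mul_right (hj.trans_lt hk') (Nat.zero_le _)
    have h₂ : k < j := lt_of_mul_lt_mul_right (hk.trans_le hj') (Nat.zero_le _)
    omega

/-- For `m = rt + 1`, the genus of the semigroup generated by the consecutive
integers `m - t, …, m` is `(m-1)(r-1)/2`. -/
theorem stmt_5 (r t m : ℕ) (hr : 2 ≤ r) (ht : 1 ≤ t) (hm : m = r * t + 1)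
    (H : AddSubmonoid ℕ)
    (hH : H = AddSubmonoid.closure {k : ℕ | m - t ≤ k ∧ k ≤ m}) :
    {x : ℕ | x ∉ H}.ncard = (m - 1) * (r - 1) / 2 := by
  obtain ⟨s, rfl⟩ : ∃ s, r = s + 1 := ⟨r - 1, by omega⟩
  have hmt : m - t = s * t + 1 := by rw [hm, add_mul]; omega
  rw [hmt, hm] at hH
  have hgaps : {x : ℕ | x ∉ H} = ((Finset.range s).biUnion fun k =>
      Finset.Ioo (k * ((s + 1) * t + 1)) ((k + 1) * (s * t + 1)) : Finset ℕ) := by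
    ext x
    rw [Set.mem_ofPred_eq, hH, notMem_closure_interval_iff]
    simp only [Finset.mem_coe, Finset.mem_biUnion, Finset.mem_range, Finset.mem_Ioo]
  rw [hgaps, Set.ncard_coe_finset, Finset.card_biUnion]
  · have hcard : ∀ k ∈ Finset.range s,
        (Finset.Ioo (k * ((s + 1) * t + 1)) ((k + 1) * (s * t + 1))).card
          = (s - 1 - k + 1) * t := by
      intro k hk
      obtain ⟨d, rfl⟩ := Nat.exists_eq_add_of_lt (Finset.mem_range.mp hk)
      have hd : k + d + 1 - 1 - k + 1 = d + 1 := by omega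
      have hlen : (k + 1) * ((k + d + 1) * t + 1)
          = k * ((k + d + 1 + 1) * t + 1) + (d + 1) * t + 1 := by ring
      rw [Nat.card_Ioo, hd, hlen]
      omega
    rw [Finset.sum_congr rfl hcard, Finset.sum_range_reflect (fun k => (k + 1) * t) s,
      ← Finset.sum_mul]
    have hsum : (∑ k ∈ Finset.range s, (k + 1)) * 2 = (s + 1) * s := by
      have h := Finset.sum_range_id_mul_two (s + 1)
      rwa [Finset.sum_range_succ', add_zero, Nat.add_sub_cancel] at h
    rw [hm, Nat.add_sub_cancel, Nat.add_sub_cancel]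
    symm
    apply Nat.div_eq_of_eq_mul_left two_pos
    rw [mul_right_comm (Finset.sum _ _), hsum]
    ring
  · intro i _ j _ hij
    rw [Function.onFun, Finset.disjoint_left]
    intro x hx hx'
    rw [Finset.mem_Ioo] at hx hx'
    have hab : s * t + 1 ≤ (s + 1) * t + 1 := by gcongr; omega
    have h₁ := hx.1.trans (hx'.2.trans_le (Nat.mul_le_mul_left _ hab))
    have h₂ := hx'.1.trans (hx.2.trans_le (Nat.mul_le_mul_left _ hab))
    have h₃ := lt_of_mul_lt_mul_right h₁ (Nat.zero_le _)
    have h₄ := lt_of_mul_lt_mul_right h₂ (Nat.zero_le _)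
    omega
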